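/- The infinite Fibonacci word contains no fourth power: for every nonempty finite string x, the string x·x·x·x is not a substring of any Fibonacci word F_i, where F_0 = a, F_1 = b, and F_{i+2} = F_{i+1}·F_i. -/

import Mathlib

/-- Fibonacci words over the alphabet `Fin 2` (with `a = 0`, `b = 1`):
`F₀ = a`, `F₁ = b`, `F_{i+2} = F_{i+1} · F_i`. -/
def fibWord : ℕ → List (Fin 2)
  | 0 => [0]
  | 1 => [1]
  | (n + 2) => fibWord (n + 1) ++ fibWord n

/-- The Fibonacci morphism `b ↦ ba`, `a ↦ b`. -/
def phi (w : List (Fin 2)) : List (Fin 2) := w.flatMap (fun c => if c = 0 then [1] else [1, 0])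

theorem phi_nil : phi [] = [] := rfl
theorem phi_append (u v : List (Fin 2)) : phi (u ++ v) = phi u ++ phi v := by
  simp [phi]
theorem phi_c0 (v : List (Fin 2)) : phi (0 :: v) = 1 :: phi v := by
  simp [phi]
theorem phi_c1 (v : List (Fin 2)) : phi (1 :: v) = 1 :: 0 :: phi v := by
  simp [phi]

theorem fin2 (c : Fin 2) : c = 0 ∨ c = 1 := by omega

theorem phi_fib (i : ℕ) : phi (fibWord i) = fibWord (i + 1) := by
  induction i using Nat.strong_induction_on with
  | _ i ih =>
    match i with
    | 0 => simp [fibWord, phi]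
    | 1 => simp [fibWord, phi]
    | n + 2 =>
      rw [fibWord, phi_append, ih (n + 1) (by omega), ih n (by omega)]
      simp [fibWord]

theorem phi_head (w t : List (Fin 2)) : phi w ≠ 0 :: t := by
  cases w with
  | nil => simp [phi]
  | cons c w => rcases fin2 c with rfl | rfl <;> simp [phi_c0, phi_c1]

theorem phi_no00 (w p s : List (Fin 2)) : phi w ≠ p ++ 0 :: 0 :: s := by
  induction w generalizing p with
  | nil => simp [phi]
  | cons c w ih =>
    intro h
    rcases fin2 c with rfl | rfl
    · rw [phi_c0] at h
      rcases p with _ | ⟨d, p⟩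
      · simp at h
      · simp at h; exact ih p h.2
    · rw [phi_c1] at h
      rcases p with _ | ⟨d, _ | ⟨e, p⟩⟩
      · simp at h
      · simp at h; exact phi_head _ _ h.2
      · simp at h; exact ih p h.2.2

theorem phi_cut (w p q : List (Fin 2)) (h : phi w = p ++ q) (hq : ∀ t, q ≠ 0 :: t) :
    ∃ w1 w2, w = w1 ++ w2 ∧ phi w1 = p ∧ phi w2 = q := by
  induction w generalizing p with
  | nil =>
    simp [phi] at h
    exact ⟨[], [], rfl, by simp [phi, h.1], by simp [phi, h.2]⟩
  | cons c w ih =>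
    rcases p with _ | ⟨d, p⟩
    · exact ⟨[], c :: w, rfl, rfl, h⟩
    rcases fin2 c with rfl | rfl
    · rw [phi_c0] at h
      simp at h
      obtain ⟨w1, w2, rfl, h1, h2⟩ := ih p h.2
      exact ⟨0 :: w1, w2, rfl, by simp [phi_c0, h1, h.1], h2⟩
    · rw [phi_c1] at h
      rcases p with _ | ⟨e, p⟩
      · simp at h
        exact absurd h.2.symm (hq _)
      · simp at h
        obtain ⟨w1, w2, rfl, h1, h2⟩ := ih p h.2.2
        exact ⟨1 :: w1, w2, rfl, by rw [phi_c1, h1, ← h.1, ← h.2.1], h2⟩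

theorem phi_inj (u v : List (Fin 2)) (h : phi u = phi v) : u = v := by
  induction u generalizing v with
  | nil =>
    rcases v with _ | ⟨d, v⟩
    · rfl
    · rcases fin2 d with rfl | rfl <;> simp [phi_c0, phi_c1, phi_nil] at h
  | cons c u ih =>
    rcases v with _ | ⟨d, v⟩
    · rcases fin2 c with rfl | rfl <;> simp [phi_c0, phi_c1, phi_nil] at h
    · rcases fin2 c with rfl | rfl <;> rcases fin2 d with rfl | rfl <;>
        simp [phi_c0, phi_c1] at h
      · rw [ih v h]
      · exact absurd h (phi_head _ _)
      · exact absurd h.symm (phi_head _ _)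
      · rw [ih v h]

/-- `w` contains a fourth power with its last letter removed. -/
def Near (w : List (Fin 2)) : Prop :=
  ∃ p s z c, w = p ++ ((z ++ [c]) ++ ((z ++ [c]) ++ ((z ++ [c]) ++ (z ++ s))))

/-- Case where the root starts with `b`. -/
theorem desc1 (w p s z t : List (Fin 2)) (c : Fin 2) (hw : ∀ p s, w ≠ p ++ 0 :: 0 :: s)
    (hz : z ++ [c] = 1 :: t)
    (h : phi w = p ++ ((z ++ [c]) ++ ((z ++ [c]) ++ ((z ++ [c]) ++ (z ++ s))))) : Near w := by
  have key : ∀ q t', (z ++ [c]) ++ q ≠ 0 :: t' := by intro q t'; rw [hz]; simp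
  obtain ⟨w0, r0, rfl, -, h1⟩ := phi_cut _ _ _ h (key _)
  obtain ⟨y, r1, rfl, hy, h2⟩ := phi_cut _ _ _ h1 (key _)
  obtain ⟨y2, r2, rfl, hy2, h3⟩ := phi_cut _ _ _ h2 (key _)
  have e2 := phi_inj _ _ (hy2.trans hy.symm)
  subst e2
  have hq : ∀ t', z ++ s ≠ 0 :: t' := by
    intro t' ht
    rcases z with _ | ⟨d, z⟩
    · simp at hz
      have hy0 : y2 = [0] := phi_inj _ _ (by rw [hy2, hz.1]; rfl)
      subst hy0
      exact hw w0 r2 (by simp)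
    · simp at hz ht
      simp [hz.1] at ht
  obtain ⟨y3, r3, rfl, hy3, h4⟩ := phi_cut _ _ _ h3 hq
  have e3 := phi_inj _ _ (hy3.trans hy2.symm)
  subst e3
  rcases List.eq_nil_or_concat' y3 with rfl | ⟨v, d, rfl⟩
  · simp [phi] at hy
  rw [phi_append] at hy
  rcases fin2 d with rfl | rfl
  · have hv : phi v = z ∧ 1 = c := by
      simpa [phi_c0, phi_nil] using List.append_inj' hy rfl
    obtain ⟨rfl, rfl⟩ := hv
    by_cases hs : ∃ t, s = 0 :: t
    · obtain ⟨s, rfl⟩ := hs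
      rcases List.eq_nil_or_concat' v with rfl | ⟨v, e, rfl⟩
      · exact ⟨w0, r3, [], 0, by simp⟩
      · rcases fin2 e with rfl | rfl
        · exact absurd (by simp) (hw (w0 ++ v) ((v ++ [0] ++ [0]) ++ ((v ++ [0] ++ [0]) ++ r3)))
        · exact absurd (by rw [h4, phi_append]; simp [phi_c1, phi_nil])
            (phi_no00 r3 (phi v ++ [1]) s)
    · push Not at hs
      obtain ⟨a, b, rfl, ha, hb⟩ := phi_cut _ _ _ h4 hs
      have := phi_inj _ _ ha
      subst this
      exact ⟨w0, b, a, 0, by simp⟩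
  · have hv : phi v ++ [1] = z ∧ 0 = c := by
      have : (phi v ++ [1]) ++ [0] = z ++ [c] := by rw [← hy]; simp [phi_c1, phi_nil]
      simpa using List.append_inj' this rfl
    obtain ⟨rfl, rfl⟩ := hv
    obtain ⟨a, b, rfl, ha, hb⟩ := phi_cut r3 (phi v) (1 :: s) (by simp [h4]) (by simp)
    have := phi_inj _ _ ha
    subst this
    exact ⟨w0, b, a, 1, by simp⟩

theorem desc (w : List (Fin 2)) (hw : ∀ p s, w ≠ p ++ 0 :: 0 :: s) (h : Near (phi w)) :
    Near w := by
  obtain ⟨p, s, z, c, h⟩ := h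
  rcases z with _ | ⟨d, z⟩
  · rcases fin2 c with rfl | rfl
    · exact absurd (by simpa using h) (phi_no00 w p (0 :: s))
    · exact desc1 w p s [] [] 1 hw rfl h
  rcases fin2 d with rfl | rfl
  · rcases fin2 c with rfl | rfl
    · exact absurd (by rw [h]; simp)
        (phi_no00 w (p ++ 0 :: z) (z ++ [0] ++ ((0 :: z ++ [0]) ++ (0 :: z ++ s))))
    · rcases List.eq_nil_or_concat' p with rfl | ⟨p, e, rfl⟩
      · exact absurd h (phi_head _ _)
      rcases fin2 e with rfl | rfl
      · exact absurd (by rw [h]; simp; rfl) (phi_no00 w p _)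
      · rcases List.eq_nil_or_concat' z with rfl | ⟨z, f, rfl⟩
        · exact desc1 w p (0 :: s) [1] [0] 0 hw rfl (by simpa using h)
        · exact desc1 w p (f :: s) (1 :: 0 :: z) (0 :: z ++ [f]) f hw (by simp) (by simpa using h)
  · exact desc1 w p s (1 :: z) (z ++ [c]) c hw (by simp) h

theorem fib_no00 (i : ℕ) (p s : List (Fin 2)) : fibWord i ≠ p ++ 0 :: 0 :: s := by
  cases i with
  | zero =>
    intro h
    have := congrArg List.length h
    simp [fibWord] at this
    omega
  | succ i => rw [← phi_fib]; exact phi_no00 _ _ _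

theorem fib_near (i : ℕ) : ¬ Near (fibWord i) := by
  induction i with
  | zero =>
    rintro ⟨p, s, z, c, h⟩
    have := congrArg List.length h
    simp [fibWord] at this
    omega
  | succ i ih => rw [← phi_fib]; exact fun h => ih (desc _ (fib_no00 i) h)

/-- No Fibonacci word contains a fourth power: for every nonempty string `x`,
`x·x·x·x` is not a substring of any `F_i`. -/
theorem stmt5 (i : ℕ) (x : List (Fin 2)) (hx : x ≠ []) :
    ¬ (x ++ x ++ x ++ x <:+: fibWord i) := by
  rintro ⟨p, s, h⟩
  rcases List.eq_nil_or_concat' x with rfl | ⟨z, c, rfl⟩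
  · exact hx rfl
  · exact fib_near i ⟨p, c :: s, z, c, by rw [← h]; simp⟩
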